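/- (Modified Sylvester criterion, single-step form.) Let S be a real symmetric n×n matrix, 1 ≤ m ≤ n, and let A be a real n×(n−1) matrix with AᵀA = I_{n−1}. Then S ∈ K_m(n) if and only if T_m(S) > 0 and AᵀSA ∈ K_{m−1}(n−1). -/

import Mathlib

open Matrix

/-- The `p`-trace of a square real matrix: the sum of all `p × p` principal minors.
    `ptrace 0 S = 1`. -/
noncomputable def ptrace {ι : Type*} [Fintype ι] (p : ℕ) (S : Matrix ι ι ℝ) : ℝ := by
  classical
  exact ∑ t ∈ Finset.univ.powersetCard p,
    (S.submatrix (Subtype.val : {x // x ∈ t} → ι) Subtype.val).det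

/-- The Gårding cone `K_m(n)`: real symmetric `n × n` matrices with `T_p > 0`
    for `p = 1, …, m`. -/
noncomputable def gardingCone (n m : ℕ) : Set (Matrix (Fin n) (Fin n) ℝ) :=
  {S | S.IsSymm ∧ ∀ p, 1 ≤ p → p ≤ m → 0 < ptrace p S}

open Polynomial in
/-- The derivative of a real-rooted polynomial is real-rooted. -/
theorem Polynomial.Splits.derivative_real {p : ℝ[X]} (hp : p.Splits) :
    (derivative p).Splits := by
  rw [splits_iff_card_roots] at hp ⊢
  have h1 := card_roots_le_derivative p
  have h2 := natDegree_derivative_le p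
  have h3 := card_roots' (derivative p)
  omega

open Polynomial in
theorem Polynomial.Splits.iterate_derivative_real {p : ℝ[X]} (hp : p.Splits) (k : ℕ) :
    (derivative^[k] p).Splits := by
  induction k with
  | zero => exact hp
  | succ k ih => rw [Function.iterate_succ_apply']; exact ih.derivative_real

open Polynomial in
theorem Polynomial.coeff_prod_X_sub_C_pos (s : Multiset ℝ) (hs : ∀ r ∈ s, r < 0) :
    ∀ j ≤ Multiset.card s, 0 < ((s.map fun r => X - C r).prod).coeff j := by
  induction s using Multiset.induction_on with
  | empty => simp
  | cons a s ih =>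
    intro j hj
    have ha : a < 0 := hs a (Multiset.mem_cons_self a s)
    have ih := ih fun r hr => hs r (Multiset.mem_cons_of_mem hr)
    rw [Multiset.card_cons] at hj
    rw [Multiset.map_cons, Multiset.prod_cons, sub_mul, coeff_sub, coeff_C_mul]
    have hnn : ∀ i, 0 ≤ ((s.map fun r => X - C r).prod).coeff i := by
      intro i
      rcases le_or_gt i (Multiset.card s) with h | h
      · exact (ih i h).le
      · rw [coeff_eq_zero_of_natDegree_lt]
        rwa [natDegree_multiset_prod_X_sub_C_eq_card]
    rcases j with _ | j
    · rw [coeff_X_mul_zero]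
      nlinarith [ih 0 (Nat.zero_le _)]
    · rw [coeff_X_mul]
      nlinarith [ih j (by omega), hnn (j + 1)]

open Polynomial in
/-- A real-rooted polynomial with nonnegative coefficients and positive constant term has no
vanishing coefficient up to its degree. -/
theorem Polynomial.Splits.coeff_pos_of_coeff_nonneg {q : ℝ[X]} (hq : q.Splits)
    (hnn : ∀ j, 0 ≤ q.coeff j) (h0 : 0 < q.coeff 0) :
    ∀ j ≤ q.natDegree, 0 < q.coeff j := by
  intro j hj
  have hq0 : q ≠ 0 := by rintro rfl; simp at h0
  have hneg : ∀ r ∈ q.roots, r < 0 := by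
    intro r hr
    by_contra! hr0
    have he : q.eval r = 0 := (mem_roots hq0).1 hr
    rw [eval_eq_sum_range] at he
    have hle := Finset.single_le_sum (f := fun i => q.coeff i * r ^ i)
      (fun i _ => mul_nonneg (hnn i) (pow_nonneg hr0 i))
      (Finset.mem_range.2 (Nat.succ_pos q.natDegree))
    simp only [pow_zero, mul_one] at hle
    linarith
  have hlead : 0 < q.leadingCoeff :=
    lt_of_le_of_ne (hnn _) (leadingCoeff_ne_zero.2 hq0).symm
  rw [hq.eq_prod_roots, coeff_C_mul]
  exact mul_pos hlead (coeff_prod_X_sub_C_pos _ hneg j (hq.natDegree_eq_card_roots ▸ hj))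

theorem ptrace_eq_sum {ι : Type*} [Fintype ι] [DecidableEq ι] (p : ℕ) (S : Matrix ι ι ℝ) :
    ptrace p S = ∑ t ∈ Finset.univ.powersetCard p,
      (S.submatrix (Subtype.val : t → ι) Subtype.val).det := by
  unfold ptrace
  refine Finset.sum_congr rfl fun t _ => ?_
  convert rfl

theorem ptrace_zero {ι : Type*} [Fintype ι] (S : Matrix ι ι ℝ) : ptrace 0 S = 1 := by
  classical
  simp [ptrace_eq_sum]

open Polynomial in
theorem ptrace_eq_coeff_det {ι : Type*} [Fintype ι] [DecidableEq ι] (p : ℕ)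
    (S : Matrix ι ι ℝ) :
    ptrace p S = (det (1 + (X : ℝ[X]) • S.map C)).coeff p := by
  rw [coeff_det_one_add_X_smul_eq_sum_minors, ptrace_eq_sum]

theorem charpoly_coeff_eq_ptrace {ι : Type*} [Fintype ι] [DecidableEq ι] {p : ℕ}
    (hp : p ≤ Fintype.card ι) (S : Matrix ι ι ℝ) :
    S.charpoly.coeff (Fintype.card ι - p) = (-1) ^ p * ptrace p S := by
  rw [charpoly_coeff_eq_sum_minors _ _ hp, ptrace_eq_sum]

theorem charpoly_neg_coeff_eq_ptrace {ι : Type*} [Fintype ι] [DecidableEq ι] {p : ℕ}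
    (hp : p ≤ Fintype.card ι) (S : Matrix ι ι ℝ) :
    (-S).charpoly.coeff (Fintype.card ι - p) = ptrace p S := by
  rw [charpoly_coeff_eq_sum_minors _ _ hp, ptrace_eq_sum, Finset.mul_sum]
  refine Finset.sum_congr rfl fun t ht => ?_
  rw [submatrix_neg, Pi.neg_apply, Pi.neg_apply, det_neg, Fintype.card_coe,
    (Finset.mem_powersetCard.mp ht).2, ← mul_assoc, ← mul_pow]
  simp

/-- The `p`-trace is invariant under orthogonal conjugation. -/
theorem ptrace_orthogonal_conj {ι : Type*} [Fintype ι] [DecidableEq ι] {p : ℕ}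
    (hp : p ≤ Fintype.card ι) (S Q : Matrix ι ι ℝ) (hQ : Qᵀ * Q = 1) :
    ptrace p (Qᵀ * S * Q) = ptrace p S := by
  have h : (Qᵀ * S * Q).charpoly = S.charpoly := by
    rw [charpoly_mul_comm, ← Matrix.mul_assoc, mul_eq_one_comm.1 hQ, Matrix.one_mul]
  have h1 := charpoly_coeff_eq_ptrace hp (Qᵀ * S * Q)
  rw [h, charpoly_coeff_eq_ptrace hp S] at h1
  exact (mul_left_cancel₀ (pow_ne_zero _ (by norm_num)) h1).symm

open Polynomial in
/-- If the `p`-traces of a symmetric matrix are nonnegative for `p ≤ m` and the `m`-trace is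
positive, then all `p`-traces with `p ≤ m` are positive. -/
theorem ptrace_pos_of_nonneg {ι : Type*} [Fintype ι] {S : Matrix ι ι ℝ}
    (hS : S.IsSymm) {m : ℕ} (hm : m ≤ Fintype.card ι) (hnn : ∀ p ≤ m, 0 ≤ ptrace p S)
    (hpos : 0 < ptrace m S) : ∀ p ≤ m, 0 < ptrace p S := by
  classical
  intro p hp
  have hherm : (-S).IsHermitian := by
    rw [IsHermitian, conjTranspose_eq_transpose_of_trivial, transpose_neg, hS.eq]
  set N := Fintype.card ι with hN
  set q : ℝ[X] := derivative^[N - m] (-S).charpoly with hq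
  have hsplit : q.Splits := hherm.splits_charpoly.iterate_derivative_real _
  have hcoeff : ∀ j ≤ m, q.coeff j =
      ((j + (N - m)).descFactorial (N - m) : ℝ) * ptrace (m - j) S := by
    intro j hj
    rw [hq, coeff_iterate_derivative, nsmul_eq_mul,
      ← charpoly_neg_coeff_eq_ptrace (p := m - j) (by omega) S]
    congr 2
    omega
  have hfac : ∀ j, (0 : ℝ) < ((j + (N - m)).descFactorial (N - m) : ℝ) := fun j => by
    exact_mod_cast Nat.descFactorial_pos.2 (Nat.le_add_left _ _)
  have hdeg : q.natDegree ≤ m := by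
    have h := natDegree_iterate_derivative (-S).charpoly (N - m)
    rw [charpoly_natDegree_eq_dim] at h
    exact h.trans (by omega)
  have hm' : m ≤ q.natDegree := by
    refine le_natDegree_of_ne_zero ?_
    rw [hcoeff m le_rfl, Nat.sub_self, ptrace_zero, mul_one]
    exact (hfac m).ne'
  have hqnn : ∀ j, 0 ≤ q.coeff j := by
    intro j
    rcases le_or_gt j m with h | h
    · rw [hcoeff j h]
      exact mul_nonneg (hfac j).le (hnn _ (Nat.sub_le _ _))
    · rw [coeff_eq_zero_of_natDegree_lt (by omega)]
  have hq0 : 0 < q.coeff 0 := by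
    rw [hcoeff 0 (Nat.zero_le _)]
    exact mul_pos (hfac 0) hpos
  have h := hsplit.coeff_pos_of_coeff_nonneg hqnn hq0 (m - p) (by omega)
  rw [hcoeff _ (Nat.sub_le _ _), Nat.sub_sub_self hp] at h
  exact pos_of_mul_pos_right h (hfac _).le

theorem det_add_single_zero_zero {R : Type*} [CommRing R] {n : ℕ}
    (M : Matrix (Fin (n + 1)) (Fin (n + 1)) R) (t : R) :
    det (M + Matrix.single 0 0 t) = det M + t * det (M.submatrix Fin.succ Fin.succ) := by
  have hsub : ∀ j : Fin (n + 1), (M + Matrix.single 0 0 t).submatrix Fin.succ j.succAbove =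
      M.submatrix Fin.succ j.succAbove := by
    intro j
    ext a b
    simp [(Fin.succ_ne_zero a).symm]
  rw [det_succ_row_zero, det_succ_row_zero M, Fin.sum_univ_succ, Fin.sum_univ_succ]
  simp_rw [hsub]
  simp [(Fin.succ_ne_zero _).symm]
  ring

open Polynomial in
theorem ptrace_succ_add_single {n : ℕ} (p : ℕ) (M : Matrix (Fin (n + 1)) (Fin (n + 1)) ℝ)
    (t : ℝ) :
    ptrace (p + 1) (M + Matrix.single 0 0 t) =
      ptrace (p + 1) M + t * ptrace p (M.submatrix Fin.succ Fin.succ) := by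
  have h : (1 + (X : ℝ[X]) • (M + Matrix.single 0 0 t).map C) =
      (1 + (X : ℝ[X]) • M.map C) + Matrix.single 0 0 (X * C t) := by
    ext1 i j
    simp only [Matrix.add_apply, Matrix.smul_apply, Matrix.map_apply, Matrix.single_apply,
      smul_eq_mul, C_add, mul_add, ← add_assoc]
    split_ifs <;> simp
  have h' : (1 + (X : ℝ[X]) • M.map C).submatrix Fin.succ Fin.succ =
      1 + (X : ℝ[X]) • (M.submatrix Fin.succ Fin.succ).map C := by
    ext1 i j
    simp [Matrix.one_apply]
  rw [ptrace_eq_coeff_det, h, det_add_single_zero_zero, h', coeff_add, mul_assoc, coeff_X_mul,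
    coeff_C_mul, ← ptrace_eq_coeff_det, ← ptrace_eq_coeff_det]

/-- A family of `n` orthonormal vectors in `ℝⁿ⁺¹`, given as the columns of `A`, is the family of
all columns but the first of an orthogonal matrix. -/
theorem exists_orthogonal_extension {n : ℕ} (A : Matrix (Fin (n + 1)) (Fin n) ℝ)
    (hA : Aᵀ * A = 1) :
    ∃ Q : Matrix (Fin (n + 1)) (Fin (n + 1)) ℝ, Qᵀ * Q = 1 ∧ Q.submatrix id Fin.succ = A := by
  obtain ⟨v, hv0, hv⟩ : ∃ v : Fin (n + 1) → ℝ, v ≠ 0 ∧ Aᵀ *ᵥ v = 0 := by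
    have hker : LinearMap.ker (Matrix.mulVecLin Aᵀ) ≠ ⊥ :=
      LinearMap.ker_ne_bot_of_finrank_lt (by simp)
    obtain ⟨v, hv, hv0⟩ := Submodule.exists_mem_ne_zero_of_ne_bot hker
    exact ⟨v, hv0, hv⟩
  have hpos : 0 < v ⬝ᵥ v :=
    lt_of_le_of_ne (Finset.sum_nonneg fun i _ => mul_self_nonneg (v i))
      fun h => hv0 (dotProduct_self_eq_zero.1 h.symm)
  set w : Fin (n + 1) → ℝ := (Real.sqrt (v ⬝ᵥ v))⁻¹ • v with hw
  have hww : w ⬝ᵥ w = 1 := by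
    rw [hw, smul_dotProduct, dotProduct_smul, smul_eq_mul, smul_eq_mul, ← mul_assoc, ← mul_inv,
      Real.mul_self_sqrt hpos.le, inv_mul_cancel₀ hpos.ne']
  have hAw : Aᵀ *ᵥ w = 0 := by rw [hw, mulVec_smul, hv, smul_zero]
  refine ⟨Matrix.of fun i => Fin.cons (w i) (A i), ?_, by ext i j; simp⟩
  ext i j
  refine Fin.cases ?_ (fun i => ?_) i <;> refine Fin.cases ?_ (fun j => ?_) j
  · simpa [Matrix.mul_apply, dotProduct] using hww
  · have h := congrFun hAw j
    simp only [mulVec, dotProduct, transpose_apply, Pi.zero_apply] at h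
    simpa [Matrix.mul_apply, Matrix.one_apply, (Fin.succ_ne_zero j).symm, mul_comm] using h
  · have h := congrFun hAw i
    simp only [mulVec, dotProduct, transpose_apply, Pi.zero_apply] at h
    simpa [Matrix.mul_apply, Matrix.one_apply] using h
  · have h := congrFun (congrFun hA i) j
    simpa [Matrix.mul_apply, Matrix.one_apply] using h

/-- The smallest `t` making finitely many increasing affine functions of `t` nonnegative. -/
theorem exists_affine_nonneg_and_zero (e f : ℕ → ℝ) {k : ℕ} (hk : 0 < k)
    (hf : ∀ p < k, 0 < f p) :
    ∃ t : ℝ, (∀ p < k, 0 ≤ e p + t * f p) ∧ ∃ p < k, e p + t * f p = 0 := by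
  obtain ⟨p, hp, hmax⟩ := Finset.exists_max_image (Finset.range k) (fun p => -e p / f p)
    ⟨0, Finset.mem_range.2 hk⟩
  rw [Finset.mem_range] at hp
  refine ⟨-e p / f p, fun q hq => ?_, p, hp, ?_⟩
  · have h := hmax q (Finset.mem_range.2 hq)
    rw [div_le_iff₀ (hf q hq)] at h
    linarith
  · rw [div_mul_cancel₀ _ (hf p hp).ne']
    ring

/-- modified Sylvester criterion, single-step form: let `S` be a real
symmetric `(n+1) × (n+1)` matrix, `1 ≤ m ≤ n+1`, and `A` a real `(n+1) × n` matrix with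
`Aᵀ A = I`. Then `S ∈ K_m(n+1)` iff `T_m(S) > 0` and `Aᵀ S A ∈ K_{m-1}(n)`. -/
theorem modified_sylvester_single (n m : ℕ) (h1 : 1 ≤ m) (h2 : m ≤ n + 1)
    (S : Matrix (Fin (n + 1)) (Fin (n + 1)) ℝ) (hS : S.IsSymm)
    (A : Matrix (Fin (n + 1)) (Fin n) ℝ) (hA : Aᵀ * A = 1) :
    S ∈ gardingCone (n + 1) m ↔
      0 < ptrace m S ∧ Aᵀ * S * A ∈ gardingCone n (m - 1) := by
  obtain ⟨Q, hQ, rfl⟩ := exists_orthogonal_extension A hA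
  set M := Qᵀ * S * Q with hM
  have hMsymm : M.IsSymm := by
    rw [IsSymm, hM, transpose_mul, transpose_mul, transpose_transpose, hS.eq, Matrix.mul_assoc]
  have hB : (Q.submatrix id Fin.succ)ᵀ * S * Q.submatrix id Fin.succ =
      M.submatrix Fin.succ Fin.succ := by
    ext i j
    simp [hM, Matrix.mul_apply]
  rw [hB]
  set B := M.submatrix Fin.succ Fin.succ with hBdef
  have hBsymm : B.IsSymm := hMsymm.submatrix _
  have hSM : ∀ p ≤ n + 1, ptrace p S = ptrace p M := fun p hp =>
    (ptrace_orthogonal_conj (by simpa using hp) S Q hQ).symm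
  -- No symmetric matrix of the pencil has a vanishing trace below a positive one.
  have key : ∀ (t : ℝ) (k : ℕ), k < n + 1 →
      (∀ p < k, 0 ≤ ptrace (p + 1) M + t * ptrace p B) →
      0 < ptrace (k + 1) M + t * ptrace k B →
      ∀ p < k, 0 < ptrace (p + 1) M + t * ptrace p B := by
    intro t k hk hnn hpos p hp
    simp only [hBdef, ← ptrace_succ_add_single] at hnn hpos ⊢
    refine ptrace_pos_of_nonneg (m := k + 1) ?_ (by simpa using hk) ?_ hpos (p + 1) (by omega)
    · rw [IsSymm, transpose_add, hMsymm.eq, transpose_single]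
    · rintro (_ | q) hq
      · rw [ptrace_zero]; exact zero_le_one
      · rcases Nat.lt_or_ge q k with h | h
        · exact hnn q h
        · obtain rfl : q = k := by omega
          exact hpos.le
  constructor
  · rintro ⟨-, hpos⟩
    refine ⟨hpos m h1 le_rfl, hBsymm, fun p _ hp => ?_⟩
    have hMpos : ∀ p < m, 0 < ptrace (p + 1) M := fun p hp => by
      rw [← hSM _ (by omega)]
      exact hpos (p + 1) (by omega) (by omega)
    have hp' : p < m := by omega
    clear hp
    induction p using Nat.strong_induction_on with
    | _ p ih =>
      rcases Nat.eq_zero_or_pos p with rfl | hp0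
      · rw [ptrace_zero]; exact one_pos
      by_contra! hneg
      have ih' : ∀ q < p, 0 < ptrace q B := fun q hq => by
        rcases Nat.eq_zero_or_pos q with rfl | hq0
        · rw [ptrace_zero]; exact one_pos
        · exact ih q hq hq0 (by omega)
      obtain ⟨t, hnn, q, hq, hzero⟩ :=
        exists_affine_nonneg_and_zero (fun p => ptrace (p + 1) M) (fun p => ptrace p B) hp0 ih'
      have ht : t < 0 := by
        by_contra! ht
        nlinarith [hMpos q (by omega), mul_nonneg ht (ih' q hq).le]
      exact (key t p (by omega) hnn
        (by nlinarith [hMpos p hp', mul_nonneg_of_nonpos_of_nonpos ht.le hneg]) q hq).ne' hzero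
  · rintro ⟨hm, -, hBpos⟩
    refine ⟨hS, fun p hp1 hpm => ?_⟩
    by_contra! hneg
    rw [hSM p (by omega)] at hneg
    rw [hSM m h2] at hm
    obtain ⟨k, rfl⟩ : ∃ k, m = k + 1 := ⟨m - 1, by omega⟩
    obtain ⟨p, rfl⟩ : ∃ r, p = r + 1 := ⟨p - 1, by omega⟩
    have hBpos' : ∀ q ≤ k, 0 < ptrace q B := fun q hq => by
      rcases Nat.eq_zero_or_pos q with rfl | hq0
      · rw [ptrace_zero]; exact one_pos
      · exact hBpos q hq0 (by omega)
    have hpk : p < k := by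
      rcases Nat.lt_or_ge p k with h | h
      · exact h
      · obtain rfl : p = k := by omega
        exact absurd hm hneg.not_gt
    obtain ⟨t, hnn, q, hq, hzero⟩ :=
      exists_affine_nonneg_and_zero (fun p => ptrace (p + 1) M) (fun p => ptrace p B)
        (by omega : 0 < k) fun q hq => hBpos' q hq.le
    have ht : 0 ≤ t := by
      by_contra! ht
      nlinarith [hnn p hpk, mul_neg_of_neg_of_pos ht (hBpos' p hpk.le)]
    exact (key t k (by omega) hnn
      (by nlinarith [mul_nonneg ht (hBpos' k le_rfl).le]) q hq).ne' hzero
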